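/- Let H be a separable Hilbert space, f : H → H a Lipschitz function admitting at most a linear growth, r > 0 a fixed real, and C a nonempty closed (r,f)-prox-regular subset of H. Then for every u₀ ∈ C, the system u̇(t) + N(C,u(t)) ∋ f(u(t)), u(0) = u₀, has one and only one absolutely continuous solution u on I = [0,T], and u(t) ∈ C for all t ∈ I. -/

import Mathlib

open MeasureTheory Set Filter Topology

noncomputable section

/-- The (set-valued) metric projection onto `C`:
`P_C(y) = {z ∈ C | ‖y - z‖ = d(y,C)}`. -/
def projSet {E : Type*} [NormedAddCommGroup E] (C : Set E) (y : E) : Set E :=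
  {z | z ∈ C ∧ ‖y - z‖ = Metric.infDist y C}

/-- The proximal normal cone of `C` at `x`:
`N(C,x) = {v | ∃ s > 0, x ∈ P_C(x + s v)}`. -/
def proxNormalCone {E : Type*} [NormedAddCommGroup E] [NormedSpace ℝ E]
    (C : Set E) (x : E) : Set E :=
  {v | ∃ s : ℝ, 0 < s ∧ x ∈ projSet C (x + s • v)}

/-- `Γ^r(C,x) = {v | x ∈ P_C(x + r v)}`, the good directions to project at scale `r`. -/
def gammaSet {E : Type*} [NormedAddCommGroup E] [NormedSpace ℝ E]
    (r : ℝ) (C : Set E) (x : E) : Set E :=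
  {v | x ∈ projSet C (x + r • v)}

/-- `C` is `(r,f)`-prox-regular (`r`-prox-regular in the direction `f`): for all `x ∈ C`
and `s ∈ (0,r)`, the projection `z` of `x + s f(x)/‖f(x)‖` onto `C` is well defined
(single valued), and the normalized vector from `z` to `x + s f(x)/‖f(x)‖` belongs to
`Γ^r(C,z)` (with the convention `v/‖v‖ = 0` when `v = 0`). -/
def DirProxRegular {E : Type*} [NormedAddCommGroup E] [NormedSpace ℝ E]
    (r : ℝ) (f : E → E) (C : Set E) : Prop :=
  ∀ x ∈ C, ∀ s : ℝ, 0 < s → s < r →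
    ∃ z : E, projSet C (x + (s * ‖f x‖⁻¹) • f x) = {z} ∧
      ‖x + (s * ‖f x‖⁻¹) • f x - z‖⁻¹ • (x + (s * ‖f x‖⁻¹) • f x - z) ∈ gammaSet r C z

/-- An absolutely continuous solution of the sweeping process
`u̇(t) + N(C(t),u(t)) ∋ f(u(t))`, `u(0) = u₀`, on `[0,T]`: `u` is absolutely continuous,
i.e. `u(t) = u₀ + ∫₀ᵗ g` for some Bochner-integrable density `g` (`g = u̇` a.e.),
`u(t) ∈ C(t)` for all `t ∈ [0,T]` and `f(u(t)) - u̇(t) ∈ N(C(t),u(t))` a.e. on `[0,T]`. -/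
def IsSweepingSol {E : Type*} [NormedAddCommGroup E] [NormedSpace ℝ E] [CompleteSpace E]
    (C : ℝ → Set E) (f : E → E) (T : ℝ) (u₀ : E) (u : ℝ → E) : Prop :=
  ∃ g : ℝ → E, IntegrableOn g (Set.Icc 0 T) ∧
    (∀ t ∈ Set.Icc (0:ℝ) T, u t = u₀ + ∫ s in (0:ℝ)..t, g s) ∧
    (∀ t ∈ Set.Icc (0:ℝ) T, u t ∈ C t) ∧
    (∀ᵐ t ∂volume.restrict (Set.Icc (0:ℝ) T),
      f (u t) - g t ∈ proxNormalCone (C t) (u t))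

section SweepingProcess

variable {H : Type*} [NormedAddCommGroup H] [InnerProductSpace ℝ H]

theorem DirProxRegular.exists_projection {r : ℝ} {f : H → H} {C : Set H}
    (hC : DirProxRegular r f C) (hr : 0 < r) {x : H} (hx : x ∈ C) {h : ℝ} (hh : 0 < h)
    (hhr : h * ‖f x‖ < r) :
    ∃ z ∈ C, (∀ y ∈ C, ‖x + h • f x - z‖ ≤ ‖x + h • f x - y‖) ∧
      ∀ y ∈ C, inner ℝ (x + h • f x - z) (y - z) ≤
        ‖x + h • f x - z‖ / (2 * r) * ‖y - z‖ ^ 2 := by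
  rcases eq_or_ne (f x) 0 with h0 | h0
  · exact ⟨x, hx, by simp [h0], by simp [h0]⟩
  have hn : 0 < ‖f x‖ := norm_pos_iff.2 h0
  obtain ⟨z, hz, hg⟩ := hC x hx (h * ‖f x‖) (by positivity) hhr
  rw [mul_inv_cancel_right₀ hn.ne'] at hz hg
  have hzm : z ∈ projSet C (x + h • f x) := by rw [hz]; rfl
  refine ⟨z, hzm.1, fun y hy => ?_, fun y hy => ?_⟩
  · rw [hzm.2, ← dist_eq_norm]
    exact Metric.infDist_le_dist_of_mem hy
  set m := x + h • f x - z with hm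
  rcases eq_or_ne m 0 with hm0 | hm0
  · simp [hm0]
  have hmp : 0 < ‖m‖ := norm_pos_iff.2 hm0
  have h1 : ‖r • ‖m‖⁻¹ • m‖ ≤ ‖z + r • ‖m‖⁻¹ • m - y‖ := by
    have h2 := hg.2
    rw [add_sub_cancel_left] at h2
    exact h2.le.trans ((Metric.infDist_le_dist_of_mem hy).trans (dist_eq_norm _ _).le)
  have h3 : z + r • ‖m‖⁻¹ • m - y = r • ‖m‖⁻¹ • m - (y - z) := by abel
  rw [h3] at h1
  have h4 := pow_le_pow_left₀ (norm_nonneg _) h1 2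
  rw [norm_sub_sq_real, inner_smul_left, inner_smul_left] at h4
  simp only [conj_trivial] at h4
  have h5 : 2 * (r * (‖m‖⁻¹ * inner ℝ m (y - z))) ≤ ‖y - z‖ ^ 2 := by linarith
  have h6 : inner ℝ m (y - z) =
      ‖m‖ / (2 * r) * (2 * (r * (‖m‖⁻¹ * inner ℝ m (y - z)))) := by
    field_simp
  rw [h6]
  gcongr

theorem mem_proxNormalCone_iff {C : Set H} {x v : H} :
    v ∈ proxNormalCone C x ↔
      x ∈ C ∧ ∃ c : ℝ, 0 < c ∧ ∀ y ∈ C, inner ℝ v (y - x) ≤ c * ‖y - x‖ ^ 2 := by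
  have key : ∀ s : ℝ, ∀ y, ‖x + s • v - y‖ ^ 2 =
      ‖s • v‖ ^ 2 - 2 * s * inner ℝ v (y - x) + ‖y - x‖ ^ 2 := by
    intro s y
    have : x + s • v - y = s • v - (y - x) := by abel
    rw [this, norm_sub_sq_real, inner_smul_left]
    simp only [conj_trivial]
    ring
  constructor
  · rintro ⟨s, hs, hx, hd⟩
    refine ⟨hx, 1 / (2 * s), by positivity, fun y hy => ?_⟩
    have h1 : ‖x + s • v - x‖ ≤ ‖x + s • v - y‖ := by
      rw [hd, ← dist_eq_norm]
      exact Metric.infDist_le_dist_of_mem hy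
    have h2 := pow_le_pow_left₀ (norm_nonneg _) h1 2
    rw [key s y, add_sub_cancel_left] at h2
    rw [div_mul_eq_mul_div, le_div_iff₀ (by positivity)]
    linarith
  · rintro ⟨hx, c, hc, h⟩
    refine ⟨1 / (2 * c), by positivity, hx, ?_⟩
    refine le_antisymm ((Metric.le_infDist ⟨x, hx⟩).2 fun y hy => ?_) ?_
    · rw [dist_eq_norm]
      refine (sq_le_sq₀ (norm_nonneg _) (norm_nonneg _)).1 ?_
      rw [key _ y, add_sub_cancel_left]
      have h1 := h y hy
      have h2 : 2 * (1 / (2 * c)) * inner ℝ v (y - x) ≤ ‖y - x‖ ^ 2 := by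
        have : 2 * (1 / (2 * c)) * inner ℝ v (y - x) = inner ℝ v (y - x) / c := by
          field_simp
        rw [this, div_le_iff₀ hc]
        linarith
      linarith
    · rw [← dist_eq_norm]
      exact Metric.infDist_le_dist_of_mem hx

theorem inner_eq_zero_of_hasDerivAt {C : Set H} {γ : ℝ → H} {t c : ℝ} {v w : H}
    (hγ : HasDerivAt γ w t) (hmem : ∀ᶠ s in 𝓝 t, γ s ∈ C)
    (hv : ∀ y ∈ C, inner ℝ v (y - γ t) ≤ c * ‖y - γ t‖ ^ 2) : inner ℝ v w = 0 := by
  have hd : HasDerivAt (fun s => γ s - γ t) w t := hγ.sub_const _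
  have h1 : HasDerivAt (fun s => inner ℝ v (γ s - γ t) - c * ‖γ s - γ t‖ ^ 2)
      (inner ℝ v w) t := by
    have := ((hasDerivAt_const t v).inner ℝ hd).sub (hd.norm_sq.const_mul c)
    convert! this using 1
    simp
  refine IsLocalMax.hasDerivAt_eq_zero ?_ h1
  filter_upwards [hmem] with s hs
  have := hv _ hs
  simp only [sub_self, inner_zero_right, norm_zero]
  linarith

theorem DirProxRegular.inner_sub_le_of_hasDerivAt {r : ℝ} {f : H → H} {C : Set H}
    (hC : DirProxRegular r f C) (hr : 0 < r) {γ : ℝ → H} {t c : ℝ} {w : H}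
    (hγ : HasDerivAt γ w t) (hmem : ∀ᶠ s in 𝓝 t, γ s ∈ C) (hc : 0 ≤ c)
    (hv : ∀ y ∈ C, inner ℝ (f (γ t) - w) (y - γ t) ≤ c * ‖y - γ t‖ ^ 2) :
    ∀ y ∈ C, inner ℝ (f (γ t) - w) (y - γ t) ≤
      ‖f (γ t) - w‖ / (2 * r) * ‖y - γ t‖ ^ 2 := by
  intro y hy
  have hx : γ t ∈ C := hmem.self_of_nhds
  have horth := inner_eq_zero_of_hasDerivAt hγ hmem hv
  set x := γ t with hxdef
  set F := f x with hF
  set n := F - w with hn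
  have hev : ∀ᶠ h : ℝ in 𝓝[>] 0, 0 < h ∧ h * ‖F‖ < r := by
    refine eventually_mem_nhdsWithin.and (nhdsWithin_le_nhds ?_)
    have : Tendsto (fun h : ℝ => h * ‖F‖) (𝓝 0) (𝓝 (0 * ‖F‖)) := by
      exact tendsto_id.mul_const _
    rw [zero_mul] at this
    exact this.eventually_lt_const hr
  have hex : ∀ h : ℝ, ∃ z, 0 < h ∧ h * ‖F‖ < r → z ∈ C ∧
      (∀ y ∈ C, ‖x + h • F - z‖ ≤ ‖x + h • F - y‖) ∧
      ∀ y ∈ C, inner ℝ (x + h • F - z) (y - z) ≤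
        ‖x + h • F - z‖ / (2 * r) * ‖y - z‖ ^ 2 := by
    intro h
    by_cases hh : 0 < h ∧ h * ‖F‖ < r
    · obtain ⟨z, h1, h2⟩ := hC.exists_projection hr hx hh.1 hh.2
      exact ⟨z, fun _ => ⟨h1, h2⟩⟩
    · exact ⟨0, fun h => absurd h hh⟩
  choose z hz using hex
  have hslope : Tendsto (fun h : ℝ => h⁻¹ • (γ (t + h) - x)) (𝓝[>] 0) (𝓝 w) :=
    hγ.tendsto_slope_zero_right
  have hmem' : ∀ᶠ h : ℝ in 𝓝[>] 0, γ (t + h) ∈ C := by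
    refine nhdsWithin_le_nhds ?_
    have : Tendsto (fun h : ℝ => t + h) (𝓝 0) (𝓝 t) := by
      simpa using (tendsto_const_nhds (x := t)).add (tendsto_id (x := 𝓝 (0 : ℝ)))
    exact this.eventually hmem
  have hid : Tendsto (fun h : ℝ => h) (𝓝[>] 0) (𝓝 0) := nhdsWithin_le_nhds
  have hFn : inner ℝ F n = ‖n‖ ^ 2 := by
    have : F = n + w := by rw [hn]; abel
    rw [this, inner_add_left, real_inner_self_eq_norm_sq, real_inner_comm, horth, add_zero]
  -- the normals at the projections converge to `n`
  have hbound : ∀ᶠ h : ℝ in 𝓝[>] 0, ‖h⁻¹ • (x + h • F - z h) - n‖ ^ 2 ≤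
      ‖F - h⁻¹ • (γ (t + h) - x)‖ ^ 2 - ‖n‖ ^ 2 + 8 * c * ‖F‖ ^ 2 * h := by
    filter_upwards [hev, hmem'] with h hh hγC
    obtain ⟨hzC, hmin, -⟩ := hz h hh
    have hh0 := hh.1
    have e1 : h⁻¹ • (x + h • F - z h) = F - h⁻¹ • (z h - x) := by
      simp only [smul_sub, smul_add, inv_smul_smul₀ hh0.ne']; abel
    have e2 : ∀ q, ‖x + h • F - q‖ = h * ‖F - h⁻¹ • (q - x)‖ := by
      intro q
      have : x + h • F - q = h • (F - h⁻¹ • (q - x)) := by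
        simp only [smul_sub, smul_inv_smul₀ hh0.ne']; abel
      rw [this, norm_smul, Real.norm_of_nonneg hh0.le]
    have h1 : ‖F - h⁻¹ • (z h - x)‖ ≤ ‖F - h⁻¹ • (γ (t + h) - x)‖ := by
      have := hmin _ hγC
      rw [e2, e2] at this
      exact le_of_mul_le_mul_left this hh0
    have h2 : ‖z h - x‖ ≤ 2 * h * ‖F‖ := by
      have h3 := hmin x hx
      have h4 : ‖x + h • F - x‖ = h * ‖F‖ := by
        rw [add_sub_cancel_left, norm_smul, Real.norm_of_nonneg hh0.le]
      have h5 : z h - x = h • F - (x + h • F - z h) := by abel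
      have h6 := norm_sub_le (h • F) (x + h • F - z h)
      rw [← h5, norm_smul, Real.norm_of_nonneg hh0.le] at h6
      linarith
    have h7 : inner ℝ (h⁻¹ • (z h - x)) n ≤ 4 * c * ‖F‖ ^ 2 * h := by
      rw [inner_smul_left, real_inner_comm]
      simp only [conj_trivial]
      have h8 := hv _ hzC
      have h9 : ‖z h - x‖ ^ 2 ≤ (2 * h * ‖F‖) ^ 2 := by gcongr
      have h10 : inner ℝ n (z h - x) ≤ c * (2 * h * ‖F‖) ^ 2 := h8.trans (by gcongr)
      calc h⁻¹ * inner ℝ n (z h - x) ≤ h⁻¹ * (c * (2 * h * ‖F‖) ^ 2) := by gcongr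
        _ = 4 * c * ‖F‖ ^ 2 * h := by field_simp; ring
    rw [e1, norm_sub_sq_real, inner_sub_left, hFn]
    have h11 := pow_le_pow_left₀ (norm_nonneg _) h1 2
    linarith
  have hlim0 : Tendsto (fun h : ℝ => ‖F - h⁻¹ • (γ (t + h) - x)‖ ^ 2 - ‖n‖ ^ 2 +
      8 * c * ‖F‖ ^ 2 * h) (𝓝[>] 0) (𝓝 0) := by
    have := ((((tendsto_const_nhds (x := F)).sub hslope).norm.pow 2).sub
      (tendsto_const_nhds (x := ‖n‖ ^ 2))).add (hid.const_mul (8 * c * ‖F‖ ^ 2))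
    simpa [← hn] using this
  have hN : Tendsto (fun h : ℝ => h⁻¹ • (x + h • F - z h)) (𝓝[>] 0) (𝓝 n) := by
    rw [tendsto_iff_norm_sub_tendsto_zero]
    have hsq := squeeze_zero' (Eventually.of_forall fun h => sq_nonneg _) hbound hlim0
    have := hsq.sqrt
    simpa using this
  have hzx : Tendsto z (𝓝[>] 0) (𝓝 x) := by
    have h1 : Tendsto (fun h : ℝ => x + h • F - h • (h⁻¹ • (x + h • F - z h)))
        (𝓝[>] 0) (𝓝 (x + (0 : ℝ) • F - (0 : ℝ) • n)) :=
      ((tendsto_const_nhds (x := x)).add (hid.smul_const F)).sub (hid.smul hN)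
    simp only [zero_smul, add_zero, sub_zero] at h1
    refine h1.congr' ?_
    filter_upwards [hev] with h hh
    rw [smul_inv_smul₀ hh.1.ne']
    abel
  have hyz := (tendsto_const_nhds (x := y)).sub hzx
  refine le_of_tendsto_of_tendsto (hN.inner hyz)
    ((hN.norm.div_const (2 * r)).mul (hyz.norm.pow 2)) ?_
  filter_upwards [hev] with h hh
  have h1 := (hz h hh).2.2 y hy
  have hh0 := hh.1
  rw [inner_smul_left, norm_smul, norm_inv, Real.norm_of_nonneg hh0.le]
  simp only [conj_trivial]
  calc h⁻¹ * inner ℝ (x + h • F - z h) (y - z h)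
      ≤ h⁻¹ * (‖x + h • F - z h‖ / (2 * r) * ‖y - z h‖ ^ 2) := by gcongr
    _ = _ := by ring

theorem intervalIntegrable_of_integrableOn_Icc {E : Type*} [NormedAddCommGroup E] {g : ℝ → E}
    {T : ℝ} (hg : IntegrableOn g (Icc 0 T)) {a b : ℝ} (ha : a ∈ Icc 0 T) (hb : b ∈ Icc 0 T) :
    IntervalIntegrable g volume a b :=
  (hg.mono_set (uIcc_subset_Icc ha hb)).intervalIntegrable

theorem ae_hasDerivAt_integral_of_integrableOn [CompleteSpace H] {g : ℝ → H} {T : ℝ}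
    (hT : 0 ≤ T) (hg : IntegrableOn g (Icc 0 T)) :
    ∀ᵐ t ∂volume.restrict (Icc (0 : ℝ) T),
      t ∈ Ioo 0 T ∧ HasDerivAt (fun t => ∫ s in (0 : ℝ)..t, g s) (g t) t := by
  have hi := intervalIntegrable_of_integrableOn_Icc hg (left_mem_Icc.2 hT) (right_mem_Icc.2 hT)
  have h := hi.ae_hasDerivAt_integral
  have h0 : ∀ᵐ x : ℝ, x ≠ 0 := by simp [ae_iff, measure_singleton]
  have h1 : ∀ᵐ x : ℝ, x ≠ T := by simp [ae_iff, measure_singleton]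
  rw [ae_restrict_iff' measurableSet_Icc]
  filter_upwards [h, h0, h1] with t ht ht0 htT htm
  rw [uIcc_of_le hT] at ht
  exact ⟨⟨lt_of_le_of_ne htm.1 ht0.symm, lt_of_le_of_ne htm.2 htT⟩,
    ht htm 0 (left_mem_Icc.2 hT)⟩

theorem lipschitzOnWith_integral {g : ℝ → H} {T : ℝ} {G : NNReal}
    (hg : IntegrableOn g (Icc 0 T))
    (hG : ∀ᵐ t ∂volume.restrict (Icc (0 : ℝ) T), ‖g t‖ ≤ G) :
    LipschitzOnWith G (fun t => ∫ s in (0 : ℝ)..t, g s) (Icc 0 T) := by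
  refine LipschitzOnWith.of_dist_le_mul fun a ha b hb => ?_
  have h0 : (0 : ℝ) ∈ Icc 0 T := ⟨le_rfl, ha.1.trans ha.2⟩
  rw [dist_eq_norm, intervalIntegral.integral_interval_sub_left
    (intervalIntegrable_of_integrableOn_Icc hg h0 ha)
    (intervalIntegrable_of_integrableOn_Icc hg h0 hb), dist_eq_norm, Real.norm_eq_abs]
  refine intervalIntegral.norm_integral_le_of_norm_le_const_ae ?_
  rw [ae_restrict_iff' measurableSet_Icc] at hG
  filter_upwards [hG] with s hs hsm
  exact hs (uIcc_subset_Icc hb ha (uIoc_subset_uIcc hsm))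

theorem norm_integral_sq_le_of_inner_le [CompleteSpace H] {g : ℝ → H} {T G a b : ℝ}
    (hT : 0 ≤ T) (hg : IntegrableOn g (Icc 0 T)) (ha : 0 ≤ a) (hb : 0 ≤ b)
    (hG : ∀ᵐ t ∂volume.restrict (Icc (0 : ℝ) T), ‖g t‖ ≤ G)
    (h : ∀ᵐ t ∂volume.restrict (Icc (0 : ℝ) T),
      inner ℝ (g t) (∫ s in (0 : ℝ)..t, g s) ≤ a * ‖∫ s in (0 : ℝ)..t, g s‖ ^ 2 + b)
    {t : ℝ} (ht : t ∈ Icc 0 T) :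
    ‖∫ s in (0 : ℝ)..t, g s‖ ^ 2 ≤ 2 * b * T * Real.exp (2 * a * T) := by
  set W : ℝ → H := fun t => ∫ s in (0 : ℝ)..t, g s with hW
  have hlip : LipschitzOnWith G.toNNReal W (Icc 0 T) :=
    lipschitzOnWith_integral hg (hG.mono fun s hs => hs.trans (Real.le_coe_toNNReal G))
  have hsub : uIcc 0 t ⊆ Icc 0 T := uIcc_subset_Icc ⟨le_rfl, hT⟩ ht
  have hac1 : AbsolutelyContinuousOnInterval (fun s => ‖W s‖) 0 t := by
    refine LipschitzOnWith.absolutelyContinuousOnInterval (K := 1 * G.toNNReal) ?_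
    exact lipschitzWith_one_norm.comp_lipschitzOnWith (hlip.mono hsub)
  set ψ : ℝ → ℝ := fun s => 2 * b * s - Real.exp (-(2 * a * s)) * (‖W s‖ * ‖W s‖) with hψ
  have hac : AbsolutelyContinuousOnInterval ψ 0 t := by
    refine AbsolutelyContinuousOnInterval.fun_sub ?_ (.fun_mul ?_ (hac1.fun_mul hac1))
    · exact ContDiffOn.absolutelyContinuousOnInterval (by fun_prop)
    · exact ContDiffOn.absolutelyContinuousOnInterval (by fun_prop)
  have hder : ∀ᵐ s ∂volume.restrict (Icc (0 : ℝ) T), 0 ≤ deriv ψ s := by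
    filter_upwards [ae_hasDerivAt_integral_of_integrableOn hT hg, h, ae_restrict_mem
      measurableSet_Icc] with s hs hin hsm
    have h1 : HasDerivAt (fun s => ‖W s‖ * ‖W s‖) (2 * inner ℝ (W s) (g s)) s := by
      simpa [sq] using hs.2.norm_sq
    have h2 : HasDerivAt (fun s : ℝ => Real.exp (-(2 * a * s)))
        (Real.exp (-(2 * a * s)) * (-(2 * a))) s := by
      simpa using ((hasDerivAt_id s).const_mul (2 * a)).neg.exp
    have h3 : HasDerivAt (fun s : ℝ => 2 * b * s) (2 * b) s := by
      simpa using (hasDerivAt_id s).const_mul (2 * b)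
    rw [(h3.fun_sub (h2.fun_mul h1)).deriv, real_inner_comm]
    have hE : Real.exp (-(2 * a * s)) ≤ 1 := by
      rw [Real.exp_le_one_iff]
      have := mul_nonneg ha hsm.1
      linarith
    have hE0 := Real.exp_pos (-(2 * a * s))
    have h4 : Real.exp (-(2 * a * s)) * (inner ℝ (g s) (W s) - a * ‖W s‖ ^ 2) ≤ b :=
      calc _ ≤ Real.exp (-(2 * a * s)) * b := by gcongr; linarith
        _ ≤ 1 * b := by gcongr
        _ = b := one_mul b
    nlinarith
  have hint := hac.integral_deriv_eq_sub
  have hnn : 0 ≤ ∫ s in (0 : ℝ)..t, deriv ψ s :=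
    intervalIntegral.integral_nonneg_of_ae_restrict ht.1
      (ae_restrict_of_ae_restrict_of_subset (Icc_subset_Icc_right ht.2) hder)
  have hW0 : W 0 = 0 := intervalIntegral.integral_same
  have hψ0 : ψ 0 = 0 := by simp [hψ, hW0]
  rw [hint, hψ0, sub_zero] at hnn
  simp only [hψ, ← sq] at hnn
  rw [Real.exp_neg, sub_nonneg, inv_mul_le_iff₀ (Real.exp_pos _)] at hnn
  calc ‖W t‖ ^ 2 ≤ Real.exp (2 * a * t) * (2 * b * t) := hnn
    _ ≤ Real.exp (2 * a * T) * (2 * b * T) := by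
      have := ht.1
      have := ht.2
      gcongr
    _ = _ := by ring

/-- The velocity `v` at `x` is admissible up to an error `ε`: it is `f p - n` with `p ∈ C` and
`n` a normal of norm at most `B` at some `q ∈ C`, with `p` and `q` within `ε` of `x`. -/
def IsApproxVelocity (C : Set H) (f : H → H) (r B ε : ℝ) (x v : H) : Prop :=
  ∃ p ∈ C, ∃ q ∈ C, ‖x - p‖ ≤ ε ∧ ‖x - q‖ ≤ ε ∧ ‖f p - v‖ ≤ B ∧
    ∀ y ∈ C, inner ℝ (f p - v) (y - q) ≤ B / (2 * r) * ‖y - q‖ ^ 2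

theorem IsApproxVelocity.inner_sub_le {C : Set H} {f : H → H} {K : NNReal}
    (hf : LipschitzWith K f) {r B ε δ : ℝ} (hr : 0 < r) {x v x' v' : H}
    (h : IsApproxVelocity C f r B ε x v) (h' : IsApproxVelocity C f r B δ x' v') :
    inner ℝ (v - v') (x - x') ≤ (2 * K + 2 * B / r) * ‖x - x'‖ ^ 2 +
      ((K + 2 * B / r) * (ε + δ) ^ 2 + 2 * B * (ε + δ)) := by
  obtain ⟨p, hp, q, hq, hxp, hxq, hB, hn⟩ := h
  obtain ⟨p', hp', q', hq', hxp', hxq', hB', hn'⟩ := h'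
  have hB0 : 0 ≤ B := (norm_nonneg _).trans hB
  set n := f p - v with hndef
  set n' := f p' - v' with hndef'
  set w := x - x' with hw
  set η := ε + δ with hη
  have hη0 : 0 ≤ η := add_nonneg ((norm_nonneg _).trans hxp) ((norm_nonneg _).trans hxp')
  have e1 : inner ℝ (v - v') w = inner ℝ (f p - f p') w + inner ℝ n (q' - q) +
      inner ℝ n' (q - q') + (inner ℝ n (x' - q' - (x - q)) + inner ℝ n' (x - q - (x' - q'))) := by
    have : v - v' = (f p - f p') - n + n' := by rw [hndef, hndef']; abel
    rw [this, inner_add_left, inner_sub_left, hw]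
    simp only [inner_sub_right]
    ring
  have hpp : ‖p - p'‖ ≤ ‖w‖ + η := by
    have : p - p' = w - (x - p) + (x' - p') := by rw [hw]; abel
    rw [this]
    have := norm_add_le (w - (x - p)) (x' - p')
    have := norm_sub_le w (x - p)
    linarith
  have hqq : ‖q - q'‖ ≤ ‖w‖ + η := by
    have : q - q' = w - (x - q) + (x' - q') := by rw [hw]; abel
    rw [this]
    have := norm_add_le (w - (x - q)) (x' - q')
    have := norm_sub_le w (x - q)
    linarith
  have hd : ‖x - q - (x' - q')‖ ≤ η := (norm_sub_le _ _).trans (add_le_add hxq hxq')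
  have i1 : inner ℝ (f p - f p') w ≤ K * (‖w‖ + η) * ‖w‖ := by
    refine (real_inner_le_norm _ _).trans ?_
    have h1 := hf.dist_le_mul p p'
    rw [dist_eq_norm, dist_eq_norm] at h1
    gcongr
    exact h1.trans (by gcongr)
  have i2 : inner ℝ n (q' - q) ≤ B / (2 * r) * (‖w‖ + η) ^ 2 := by
    refine (hn q' hq').trans ?_
    rw [norm_sub_rev]
    gcongr
  have i3 : inner ℝ n' (q - q') ≤ B / (2 * r) * (‖w‖ + η) ^ 2 :=
    (hn' q hq).trans (by gcongr)
  have i4 : inner ℝ n (x' - q' - (x - q)) ≤ B * η := by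
    refine (real_inner_le_norm _ _).trans ?_
    rw [norm_sub_rev (x' - q')]
    gcongr
  have i5 : inner ℝ n' (x - q - (x' - q')) ≤ B * η := by
    refine (real_inner_le_norm _ _).trans ?_
    gcongr
  have hsq : (‖w‖ + η) ^ 2 ≤ 2 * ‖w‖ ^ 2 + 2 * η ^ 2 := by nlinarith [sq_nonneg (‖w‖ - η)]
  have hsq' : (‖w‖ + η) * ‖w‖ ≤ 2 * ‖w‖ ^ 2 + η ^ 2 := by nlinarith [sq_nonneg (‖w‖ - η)]
  have j1 : (K : ℝ) * ((‖w‖ + η) * ‖w‖) ≤ K * (2 * ‖w‖ ^ 2 + η ^ 2) := by gcongr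
  have j2 : B / (2 * r) * (‖w‖ + η) ^ 2 ≤ B / (2 * r) * (2 * ‖w‖ ^ 2 + 2 * η ^ 2) := by gcongr
  have e2 : B / (2 * r) * (2 * ‖w‖ ^ 2 + 2 * η ^ 2) = B / r * (‖w‖ ^ 2 + η ^ 2) := by
    field_simp
  have e3 : 2 * B / r = 2 * (B / r) := by ring
  rw [e1, e3]
  rw [e2] at j2
  linarith

theorem norm_integral_sub_sq_le_of_isApproxVelocity [CompleteSpace H] {C : Set H} {f : H → H}
    {K : NNReal} (hf : LipschitzWith K f) {r B ε δ T G : ℝ} (hr : 0 < r) (hB : 0 ≤ B)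
    (hε : 0 ≤ ε) (hδ : 0 ≤ δ) (hT : 0 ≤ T) {u₀ : H} {g g' : ℝ → H}
    (hg : IntegrableOn g (Icc 0 T)) (hg' : IntegrableOn g' (Icc 0 T))
    (hG : ∀ᵐ t ∂volume.restrict (Icc (0 : ℝ) T), ‖g t‖ ≤ G)
    (hG' : ∀ᵐ t ∂volume.restrict (Icc (0 : ℝ) T), ‖g' t‖ ≤ G)
    (h : ∀ᵐ t ∂volume.restrict (Icc (0 : ℝ) T),
      IsApproxVelocity C f r B ε (u₀ + ∫ s in (0 : ℝ)..t, g s) (g t))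
    (h' : ∀ᵐ t ∂volume.restrict (Icc (0 : ℝ) T),
      IsApproxVelocity C f r B δ (u₀ + ∫ s in (0 : ℝ)..t, g' s) (g' t))
    {t : ℝ} (ht : t ∈ Icc 0 T) :
    ‖(u₀ + ∫ s in (0 : ℝ)..t, g s) - (u₀ + ∫ s in (0 : ℝ)..t, g' s)‖ ^ 2 ≤
      2 * ((K + 2 * B / r) * (ε + δ) ^ 2 + 2 * B * (ε + δ)) * T *
        Real.exp (2 * (2 * K + 2 * B / r) * T) := by
  have hsub : ∀ t ∈ Icc 0 T, (∫ s in (0 : ℝ)..t, (g s - g' s)) =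
      (u₀ + ∫ s in (0 : ℝ)..t, g s) - (u₀ + ∫ s in (0 : ℝ)..t, g' s) := by
    intro t ht
    have h0 : (0 : ℝ) ∈ Icc 0 T := ⟨le_rfl, hT⟩
    rw [intervalIntegral.integral_sub (intervalIntegrable_of_integrableOn_Icc hg h0 ht)
      (intervalIntegrable_of_integrableOn_Icc hg' h0 ht)]
    abel
  rw [← hsub t ht]
  refine norm_integral_sq_le_of_inner_le (g := fun s => g s - g' s) (G := G + G) hT (hg.sub hg')
    (by positivity) (by positivity) ?_ ?_ ht
  · filter_upwards [hG, hG'] with s h1 h2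
    exact (norm_sub_le _ _).trans (add_le_add h1 h2)
  · filter_upwards [h, h', ae_restrict_mem measurableSet_Icc] with s h1 h2 hs
    rw [hsub s hs]
    exact h1.inner_sub_le hf hr h2

theorem ae_isApproxVelocity_of_mem_proxNormalCone [CompleteSpace H] {C : Set H} {f : H → H} {r : ℝ}
    (hf : Continuous f) (hr : 0 < r) (hC : DirProxRegular r f C) {T : ℝ} (hT : 0 ≤ T)
    {u₀ : H} {u g : ℝ → H} (hg : IntegrableOn g (Icc 0 T))
    (hu : ∀ t ∈ Icc (0 : ℝ) T, u t = u₀ + ∫ s in (0 : ℝ)..t, g s)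
    (huC : ∀ t ∈ Icc (0 : ℝ) T, u t ∈ C)
    (hN : ∀ᵐ t ∂volume.restrict (Icc (0 : ℝ) T), f (u t) - g t ∈ proxNormalCone C (u t)) :
    ∃ B₀ : ℝ, 0 ≤ B₀ ∧ ∀ B, B₀ ≤ B → ∀ᵐ t ∂volume.restrict (Icc (0 : ℝ) T), ‖g t‖ ≤ B ∧
      IsApproxVelocity C f r B 0 (u₀ + ∫ s in (0 : ℝ)..t, g s) (g t) := by
  have hucont : ContinuousOn (fun t => u₀ + ∫ s in (0 : ℝ)..t, g s) (Icc 0 T) := by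
    refine continuousOn_const.add ?_
    have := intervalIntegral.continuousOn_primitive_interval (a := 0) (b := T)
      (by rwa [uIcc_of_le hT])
    rwa [uIcc_of_le hT] at this
  obtain ⟨B₀, hB₀⟩ := isCompact_Icc.exists_bound_of_continuousOn (hf.comp_continuousOn hucont)
  have hB₀0 : 0 ≤ B₀ := (norm_nonneg _).trans (hB₀ 0 (left_mem_Icc.2 hT))
  refine ⟨B₀, hB₀0, fun B hB => ?_⟩
  filter_upwards [hN, ae_hasDerivAt_integral_of_integrableOn hT hg] with t ht hd
  obtain ⟨htI, hd⟩ := hd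
  have htm : t ∈ Icc 0 T := Ioo_subset_Icc_self htI
  have hd' := hd.const_add u₀
  have hbt := hB₀ t htm
  rw [hu t htm] at ht
  obtain ⟨hx, c, hc, hv⟩ := mem_proxNormalCone_iff.1 ht
  have hmem : ∀ᶠ s in 𝓝 t, u₀ + ∫ τ in (0 : ℝ)..s, g τ ∈ C := by
    filter_upwards [Ioo_mem_nhds htI.1 htI.2] with s hs
    rw [← hu s (Ioo_subset_Icc_self hs)]
    exact huC s (Ioo_subset_Icc_self hs)
  have hreg := hC.inner_sub_le_of_hasDerivAt hr hd' hmem hc.le hv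
  have horth := inner_eq_zero_of_hasDerivAt hd' hmem hv
  set x := u₀ + ∫ τ in (0 : ℝ)..t, g τ with hxdef
  have hpyth : ‖f x‖ ^ 2 = ‖f x - g t‖ ^ 2 + ‖g t‖ ^ 2 := by
    have := norm_add_sq_real (f x - g t) (g t)
    rw [sub_add_cancel, horth] at this
    linarith
  have h1 : ‖g t‖ ≤ ‖f x‖ := by
    refine (sq_le_sq₀ (norm_nonneg _) (norm_nonneg _)).1 ?_
    nlinarith [sq_nonneg ‖f x - g t‖]
  have h2 : ‖f x - g t‖ ≤ ‖f x‖ := by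
    refine (sq_le_sq₀ (norm_nonneg _) (norm_nonneg _)).1 ?_
    nlinarith [sq_nonneg ‖g t‖]
  have hfB : ‖f x‖ ≤ B := hbt.trans hB
  refine ⟨h1.trans hfB, x, hx, x, hx, by simp, by simp, h2.trans hfB, fun y hy => ?_⟩
  refine (hreg y hy).trans ?_
  have := h2.trans hfB
  gcongr

theorem IsSweepingSol.eqOn [CompleteSpace H] {C : Set H} {f : H → H} {K : NNReal} {r : ℝ}
    (hf : LipschitzWith K f) (hr : 0 < r) (hC : DirProxRegular r f C) {T : ℝ} (hT : 0 ≤ T)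
    {u₀ : H} {u v : ℝ → H} (hu : IsSweepingSol (fun _ => C) f T u₀ u)
    (hv : IsSweepingSol (fun _ => C) f T u₀ v) : EqOn u v (Icc 0 T) := by
  obtain ⟨g, hg, hug, huC, huN⟩ := hu
  obtain ⟨g', hg', hvg, hvC, hvN⟩ := hv
  obtain ⟨B, hB, h⟩ :=
    ae_isApproxVelocity_of_mem_proxNormalCone hf.continuous hr hC hT hg hug huC huN
  obtain ⟨B', hB', h'⟩ :=
    ae_isApproxVelocity_of_mem_proxNormalCone hf.continuous hr hC hT hg' hvg hvC hvN
  replace h := h _ (le_max_left B B')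
  replace h' := h' _ (le_max_right B B')
  intro t ht
  have key := norm_integral_sub_sq_le_of_isApproxVelocity hf hr (hB.trans (le_max_left B B'))
    le_rfl le_rfl hT hg hg' (h.mono fun _ h => h.1) (h'.mono fun _ h => h.1)
    (h.mono fun _ h => h.2) (h'.mono fun _ h => h.2) ht
  rw [← hug t ht, ← hvg t ht] at key
  have h0 : ‖u t - v t‖ ^ 2 ≤ 0 := by simpa using key
  have h1 : ‖u t - v t‖ = 0 := by
    rwa [sq_nonpos_iff] at h0
  exact sub_eq_zero.1 (norm_eq_zero.1 h1)

theorem intervalIntegrable_and_integral_eq_of_eq_slope [CompleteSpace H] {h : ℝ} (hh : 0 < h)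
    {x : ℕ → H}
    {g : ℝ → H} (hg : ∀ i : ℕ, ∀ t ∈ Ioc (i * h) ((i + 1) * h), g t = h⁻¹ • (x (i + 1) - x i))
    (i : ℕ) {t : ℝ} (ht : t ∈ Icc (i * h) ((i + 1) * h)) :
    IntervalIntegrable g volume 0 t ∧
      ∫ s in (0 : ℝ)..t, g s = x i - x 0 + (t - i * h) • h⁻¹ • (x (i + 1) - x i) := by
  have piece : ∀ (i : ℕ) {t : ℝ}, t ∈ Icc (i * h) ((i + 1) * h) →
      IntervalIntegrable g volume (i * h) t ∧
      ∫ s in (i * h)..t, g s = (t - i * h) • h⁻¹ • (x (i + 1) - x i) := by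
    intro i t ht
    have hEq : EqOn (fun _ => h⁻¹ • (x (i + 1) - x i)) g (uIoc (i * h) t) := by
      intro s hs
      rw [uIoc_of_le ht.1] at hs
      exact (hg i s ⟨hs.1, hs.2.trans ht.2⟩).symm
    refine ⟨intervalIntegrable_const.congr hEq, ?_⟩
    rw [← intervalIntegral.integral_const]
    refine intervalIntegral.integral_congr_ae (Eventually.of_forall fun s hs => (hEq hs).symm)
  induction i generalizing t with
  | zero =>
    have := piece 0 ht
    simpa using this
  | succ i ih =>
    have hle : (i : ℝ) * h ≤ (i + 1) * h := by gcongr; linarith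
    obtain ⟨h1, h2⟩ := ih (right_mem_Icc.2 hle)
    have h3 := piece (i + 1) ht
    push_cast at h3 ⊢
    refine ⟨h1.trans h3.1, ?_⟩
    rw [← intervalIntegral.integral_add_adjacent_intervals h1 h3.1, h2, h3.2]
    have : ((i : ℝ) + 1) * h - i * h = h := by ring
    rw [this, smul_inv_smul₀ hh.ne']
    abel

theorem exists_isApproxVelocity [CompleteSpace H] {C : Set H} {f : H → H} {r L T : ℝ}
    (hr : 0 < r) (hL : 0 < L) (hT : 0 < T) (hfL : ∀ x, ‖f x‖ ≤ L * (1 + ‖x‖))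
    (hC : DirProxRegular r f C) {u₀ : H} (hu₀ : u₀ ∈ C) :
    ∃ B : ℝ, 0 < B ∧ ∀ ε : ℝ, 0 < ε → ∃ g : ℝ → H, IntegrableOn g (Icc 0 T) ∧
      ∀ t ∈ Icc (0 : ℝ) T, ‖g t‖ ≤ 2 * B ∧
        IsApproxVelocity C f r B ε (u₀ + ∫ s in (0 : ℝ)..t, g s) (g t) := by
  set B := L * ((1 + ‖u₀‖) * Real.exp (2 * L * T)) with hBdef
  have hB : 0 < B := by positivity
  refine ⟨B, hB, fun ε hε => ?_⟩
  obtain ⟨N, hN⟩ := exists_nat_gt (max (T * B / r) (2 * B * T / ε))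
  have hN1 : T * B / r < N := (le_max_left _ _).trans_lt hN
  have hN2 : 2 * B * T / ε < N := (le_max_right _ _).trans_lt hN
  have hN0 : (0 : ℝ) < N := lt_of_le_of_lt (by positivity) hN1
  set h := T / N with hhdef
  have hh : 0 < h := by positivity
  have hNh : N * h = T := by rw [hhdef]; field_simp
  have hhB : h * B < r := by
    rw [hhdef, div_mul_eq_mul_div, div_lt_iff₀ hN0]
    rw [div_lt_iff₀ hr] at hN1
    linarith
  have hhε : 2 * B * h ≤ ε := by
    rw [hhdef, ← mul_div_assoc, div_le_iff₀ hN0]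
    rw [div_lt_iff₀ hε] at hN2
    linarith
  have hS : ∀ x : H, ∃ z, x ∈ C → z ∈ C ∧ (h * ‖f x‖ < r →
      ‖x + h • f x - z‖ ≤ h * ‖f x‖ ∧ ∀ y ∈ C, inner ℝ (x + h • f x - z) (y - z) ≤
        ‖x + h • f x - z‖ / (2 * r) * ‖y - z‖ ^ 2) := by
    intro x
    by_cases hx : x ∈ C
    · by_cases hfx : h * ‖f x‖ < r
      · obtain ⟨z, hz, h1, h2⟩ := hC.exists_projection hr hx hh hfx
        refine ⟨z, fun _ => ⟨hz, fun _ => ⟨?_, h2⟩⟩⟩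
        simpa [norm_smul, abs_of_pos hh] using h1 x hx
      · exact ⟨x, fun _ => ⟨hx, fun h => absurd h hfx⟩⟩
    · exact ⟨0, fun h => absurd h hx⟩
  choose S hS using hS
  set x : ℕ → H := fun i => S^[i] u₀ with hx
  have hxs : ∀ i, x (i + 1) = S (x i) := fun i => Function.iterate_succ_apply' S i u₀
  have hxC : ∀ i, x i ∈ C := by
    intro i
    induction i with
    | zero => exact hu₀
    | succ i ih => rw [hxs]; exact (hS _ ih).1
  have hstep : ∀ i, h * ‖f (x i)‖ < r → ‖x (i + 1) - x i‖ ≤ h * (2 * ‖f (x i)‖) := by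
    intro i hi
    have h1 := ((hS _ (hxC i)).2 hi).1
    rw [← hxs] at h1
    have h2 : x (i + 1) - x i = h • f (x i) - (x i + h • f (x i) - x (i + 1)) := by abel
    have h3 := norm_sub_le (h • f (x i)) (x i + h • f (x i) - x (i + 1))
    rw [← h2, norm_smul, Real.norm_of_nonneg hh.le] at h3
    linarith
  have hgrow : ∀ i : ℕ, i ≤ N → 1 + ‖x i‖ ≤ (1 + ‖u₀‖) * Real.exp (2 * L * (i * h)) := by
    intro i
    induction i with
    | zero => intro _; simp [hx]
    | succ i ih =>
      intro hi
      have hiN : i ≤ N := by omega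
      have h1 := ih hiN
      have h2 : (1 + ‖u₀‖) * Real.exp (2 * L * (i * h)) ≤ (1 + ‖u₀‖) * Real.exp (2 * L * T) := by
        rw [← hNh]
        gcongr
      have hfB : ‖f (x i)‖ ≤ B := (hfL _).trans (by rw [hBdef]; gcongr; exact h1.trans h2)
      have h3 := hstep i (lt_of_le_of_lt (by gcongr) hhB)
      have h4 := norm_le_norm_add_norm_sub' (x (i + 1)) (x i)
      have h5 := hfL (x i)
      calc 1 + ‖x (i + 1)‖ ≤ 1 + (‖x i‖ + h * (2 * (L * (1 + ‖x i‖)))) := by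
            have : h * (2 * ‖f (x i)‖) ≤ h * (2 * (L * (1 + ‖x i‖))) := by gcongr
            linarith
        _ = (1 + ‖x i‖) * (2 * L * h + 1) := by ring
        _ ≤ (1 + ‖u₀‖) * Real.exp (2 * L * (i * h)) * Real.exp (2 * L * h) := by
            gcongr
            exact Real.add_one_le_exp _
        _ = _ := by
            rw [mul_assoc, ← Real.exp_add]
            push_cast
            ring_nf
  have hfB : ∀ i : ℕ, i ≤ N → ‖f (x i)‖ ≤ B := by
    intro i hi
    refine (hfL _).trans ?_
    rw [hBdef, ← hNh]
    have := hgrow i hi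
    gcongr
    refine this.trans ?_
    gcongr
  set g : ℝ → H := fun t => h⁻¹ • (x (⌈t / h⌉₊ - 1 + 1) - x (⌈t / h⌉₊ - 1)) with hg
  have hgi : ∀ i : ℕ, ∀ t ∈ Ioc (i * h) ((i + 1) * h), g t = h⁻¹ • (x (i + 1) - x i) := by
    intro i t ht
    have : ⌈t / h⌉₊ = i + 1 := by
      rw [Nat.ceil_eq_iff (by omega)]
      constructor
      · rw [Nat.add_sub_cancel, lt_div_iff₀ hh]
        exact ht.1
      · rw [div_le_iff₀ hh]
        push_cast
        exact ht.2
    simp only [hg, this, Nat.add_sub_cancel]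
  have hloc : ∀ t ∈ Icc (0 : ℝ) T, ∃ i : ℕ, i < N ∧ t ∈ Icc (i * h) ((i + 1) * h) ∧
      g t = h⁻¹ • (x (i + 1) - x i) := by
    intro t ht
    have hceil : ⌈t / h⌉₊ ≤ N := by
      rw [Nat.ceil_le, div_le_iff₀ hh, hNh]
      exact ht.2
    have hNpos : 0 < N := by exact_mod_cast hN0
    refine ⟨⌈t / h⌉₊ - 1, by omega, ?_, rfl⟩
    rcases Nat.eq_zero_or_pos ⌈t / h⌉₊ with h0 | h0
    · have : t / h ≤ 0 := Nat.ceil_eq_zero.1 h0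
      rw [div_le_iff₀ hh, zero_mul] at this
      rw [h0]
      have : t = 0 := le_antisymm this ht.1
      simp [this, hh.le]
    · obtain ⟨j, hj⟩ : ∃ j, ⌈t / h⌉₊ = j + 1 := ⟨⌈t / h⌉₊ - 1, by omega⟩
      have hj' := (Nat.ceil_eq_iff (by omega)).1 hj
      rw [Nat.add_sub_cancel, lt_div_iff₀ hh, div_le_iff₀ hh] at hj'
      rw [hj, Nat.add_sub_cancel]
      push_cast at hj'
      exact ⟨hj'.1.le, hj'.2⟩
  refine ⟨g, ?_, fun t ht => ?_⟩
  · obtain ⟨i, -, hi, -⟩ := hloc T (right_mem_Icc.2 hT.le)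
    have := (intervalIntegrable_and_integral_eq_of_eq_slope hh hgi i hi).1
    rwa [intervalIntegrable_iff_integrableOn_Icc_of_le hT.le] at this
  · obtain ⟨i, hiN, hi, hgt⟩ := hloc t ht
    have hx0 : x 0 = u₀ := rfl
    have hint := (intervalIntegrable_and_integral_eq_of_eq_slope hh hgi i hi).2
    have hfi := hfB i hiN.le
    have hfr : h * ‖f (x i)‖ < r := lt_of_le_of_lt (by gcongr) hhB
    have hgB : ‖g t‖ ≤ 2 * B := by
      rw [hgt, norm_smul, norm_inv, Real.norm_of_nonneg hh.le, inv_mul_le_iff₀ hh]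
      exact (hstep i hfr).trans (by gcongr)
    have hut : u₀ + ∫ s in (0 : ℝ)..t, g s = x i + (t - i * h) • g t := by
      rw [hint, hx0, hgt]
      abel
    obtain ⟨hn1, hn2⟩ := (hS _ (hxC i)).2 hfr
    rw [← hxs] at hn1 hn2
    have hn : f (x i) - g t = h⁻¹ • (x i + h • f (x i) - x (i + 1)) := by
      rw [hgt]
      simp only [smul_sub, smul_add, inv_smul_smul₀ hh.ne']
      abel
    have hnB : ‖f (x i) - g t‖ ≤ B := by
      rw [hn, norm_smul, norm_inv, Real.norm_of_nonneg hh.le, inv_mul_le_iff₀ hh]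
      exact hn1.trans (by gcongr)
    refine ⟨hgB, x i, hxC i, x (i + 1), hxC (i + 1), ?_, ?_, hnB, fun y hy => ?_⟩
    · rw [hut, add_sub_cancel_left, norm_smul, Real.norm_eq_abs]
      have : |t - i * h| ≤ h := by rw [abs_le]; constructor <;> linarith [hi.1, hi.2]
      calc |t - i * h| * ‖g t‖ ≤ h * (2 * B) := by gcongr
        _ ≤ ε := by linarith
    · have e : x (i + 1) = x i + h • g t := by
        rw [hgt, smul_inv_smul₀ hh.ne']
        abel
      have e' : x i + (t - i * h) • g t - (x i + h • g t) = (t - i * h - h) • g t := by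
        rw [sub_smul (t - i * h)]
        abel
      rw [hut, e, e', norm_smul, Real.norm_eq_abs]
      have : |t - i * h - h| ≤ h := by rw [abs_le]; constructor <;> linarith [hi.1, hi.2]
      calc |t - i * h - h| * ‖g t‖ ≤ h * (2 * B) := by gcongr
        _ ≤ ε := by linarith
    · calc inner ℝ (f (x i) - g t) (y - x (i + 1))
          = h⁻¹ * inner ℝ (x i + h • f (x i) - x (i + 1)) (y - x (i + 1)) := by
            rw [hn, inner_smul_left]
            simp
        _ ≤ h⁻¹ * (‖x i + h • f (x i) - x (i + 1)‖ / (2 * r) * ‖y - x (i + 1)‖ ^ 2) := by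
            have := hn2 y hy
            gcongr
        _ = ‖f (x i) - g t‖ / (2 * r) * ‖y - x (i + 1)‖ ^ 2 := by
            rw [hn, norm_smul, norm_inv, Real.norm_of_nonneg hh.le]
            ring
        _ ≤ _ := by gcongr

theorem MeasureTheory.MemLp.integrable_real_inner {α : Type*} {m : MeasurableSpace α}
    {μ : Measure α} {φ ψ : α → H} (hφ : MemLp φ 2 μ) (hψ : MemLp ψ 2 μ) :
    Integrable (fun a => inner ℝ (φ a) (ψ a)) μ := by
  refine (L2.integrable_inner (𝕜 := ℝ) (hφ.toLp φ) (hψ.toLp ψ)).congr ?_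
  filter_upwards [hφ.coeFn_toLp, hψ.coeFn_toLp] with a h1 h2
  rw [h1, h2]

theorem exists_weak_limit_of_ae_norm_le [CompleteSpace H] {α : Type*} {m : MeasurableSpace α}
    {μ : Measure α} [IsFiniteMeasure μ] {G : ℕ → α → H} {M : ℝ} (hM : 0 ≤ M)
    (hG : ∀ n, AEStronglyMeasurable (G n) μ) (hGM : ∀ n, ∀ᵐ a ∂μ, ‖G n a‖ ≤ M) :
    ∃ g : α → H, MemLp g 2 μ ∧ ∃ φ : Filter ℕ, φ.NeBot ∧ φ ≤ atTop ∧
      ∀ ψ : α → H, MemLp ψ 2 μ → ∀ A : Set α, MeasurableSet A →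
        Tendsto (fun n => ∫ a in A, inner ℝ (G n a) (ψ a) ∂μ) φ
          (𝓝 (∫ a in A, inner ℝ (g a) (ψ a) ∂μ)) := by
  have hmem : ∀ n, MemLp (G n) 2 μ := fun n => .of_bound (hG n) M (hGM n)
  set F : ℕ → Lp H 2 μ := fun n => (hmem n).toLp (G n) with hF
  set R : ℝ := (measureUnivNNReal μ : ℝ) ^ (2 : ENNReal).toReal⁻¹ * M
  have hFR : ∀ n, ‖F n‖ ≤ R := fun n => Lp.norm_le_of_ae_bound hM <| by
    filter_upwards [(hmem n).coeFn_toLp, hGM n] with a h1 h2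
    rwa [h1]
  set Φ : ℕ → WeakDual ℝ (Lp H 2 μ) := fun n =>
    StrongDual.toWeakDual (InnerProductSpace.toDual ℝ (Lp H 2 μ) (F n)) with hΦ
  set φ : Ultrafilter ℕ := Ultrafilter.of atTop
  obtain ⟨ℓ, -, hℓ⟩ := (WeakDual.isCompact_closedBall (𝕜 := ℝ) (E := Lp H 2 μ) 0 R
    ).ultrafilter_le_nhds' (φ.map Φ) (by
      refine Ultrafilter.mem_map.2 (univ_mem' fun n => ?_)
      change InnerProductSpace.toDual ℝ (Lp H 2 μ) (F n) ∈ Metric.closedBall 0 R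
      rw [mem_closedBall_zero_iff, LinearIsometryEquiv.norm_map]
      exact hFR n)
  set γ : Lp H 2 μ := (InnerProductSpace.toDual ℝ (Lp H 2 μ)).symm (WeakDual.toStrongDual ℓ)
    with hγ
  refine ⟨γ, Lp.memLp γ, φ, inferInstance, Ultrafilter.of_le _, fun ψ hψ A hA => ?_⟩
  have hψA := hψ.indicator hA
  have hinner : ∀ γ' : Lp H 2 μ, inner ℝ γ' (hψA.toLp _) = ∫ a in A, inner ℝ (γ' a) (ψ a) ∂μ := by
    intro γ'
    rw [L2.inner_def, ← integral_indicator hA]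
    refine integral_congr_ae ?_
    filter_upwards [hψA.coeFn_toLp] with a ha
    rw [ha]
    by_cases haA : a ∈ A <;> simp [haA]
  have hlim : Tendsto (fun n => Φ n (hψA.toLp _)) φ (𝓝 (ℓ (hψA.toLp _))) :=
    ((WeakDual.eval_continuous (hψA.toLp _)).tendsto ℓ).comp hℓ
  have h1 : ℓ (hψA.toLp _) = ∫ a in A, inner ℝ (γ a) (ψ a) ∂μ := by
    rw [← hinner, hγ, InnerProductSpace.toDual_symm_apply]
    rfl
  rw [h1] at hlim
  refine hlim.congr fun n => ?_
  change inner ℝ (F n) (hψA.toLp _) = _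
  rw [hinner]
  refine integral_congr_ae (ae_restrict_of_ae ?_)
  filter_upwards [(hmem n).coeFn_toLp] with a ha
  rw [ha]

theorem IsApproxVelocity.inner_sub_le_add {C : Set H} {f : H → H} {K : NNReal}
    (hf : LipschitzWith K f) {r B ε ρ R : ℝ} (hr : 0 < r) {x v x' y : H}
    (h : IsApproxVelocity C f r B ε x v) (hx : ‖x - x'‖ ≤ ρ) (hy : y ∈ C) (hR : ‖y - x'‖ ≤ R) :
    inner ℝ (f x' - v) (y - x') ≤ B / (2 * r) * ‖y - x'‖ ^ 2 +
      (B / (2 * r) * (2 * R * (ε + ρ) + (ε + ρ) ^ 2) + B * (ε + ρ) + K * (ε + ρ) * R) := by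
  obtain ⟨p, hp, q, hq, hxp, hxq, hB, hn⟩ := h
  have hB0 : 0 ≤ B := (norm_nonneg _).trans hB
  set d := ε + ρ with hd
  have hd0 : 0 ≤ d := add_nonneg ((norm_nonneg _).trans hxp) ((norm_nonneg _).trans hx)
  have hpd : ‖x' - p‖ ≤ d := by
    have : x' - p = (x - p) - (x - x') := by abel
    rw [this]
    exact (norm_sub_le _ _).trans (add_le_add hxp hx)
  have hqd : ‖x' - q‖ ≤ d := by
    have : x' - q = (x - q) - (x - x') := by abel
    rw [this]
    exact (norm_sub_le _ _).trans (add_le_add hxq hx)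
  have e1 : inner ℝ (f x' - v) (y - x') = inner ℝ (f p - v) (y - q) +
      inner ℝ (f p - v) (q - x') + inner ℝ (f x' - f p) (y - x') := by
    simp only [inner_sub_left, inner_sub_right]
    ring
  have hyq : ‖y - q‖ ≤ ‖y - x'‖ + d := by
    have : y - q = (y - x') + (x' - q) := by abel
    rw [this]
    exact (norm_add_le _ _).trans (by gcongr)
  have i1 : inner ℝ (f p - v) (y - q) ≤
      B / (2 * r) * (‖y - x'‖ ^ 2 + (2 * R * d + d ^ 2)) := by
    refine (hn y hy).trans ?_
    gcongr
    calc ‖y - q‖ ^ 2 ≤ (‖y - x'‖ + d) ^ 2 := by gcongr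
      _ = ‖y - x'‖ ^ 2 + (2 * ‖y - x'‖ * d + d ^ 2) := by ring
      _ ≤ _ := by gcongr
  have i2 : inner ℝ (f p - v) (q - x') ≤ B * d := by
    refine (real_inner_le_norm _ _).trans ?_
    rw [norm_sub_rev q]
    gcongr
  have i3 : inner ℝ (f x' - f p) (y - x') ≤ K * d * R := by
    refine (real_inner_le_norm _ _).trans ?_
    have h1 := hf.dist_le_mul x' p
    rw [dist_eq_norm, dist_eq_norm] at h1
    have h2 : ‖f x' - f p‖ ≤ K * d := h1.trans (by gcongr)
    gcongr
  rw [e1]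
  linarith

theorem exists_isSweepingSol [CompleteSpace H] [TopologicalSpace.SeparableSpace H] {C : Set H}
    {f : H → H} {K : NNReal} {r L T : ℝ} (hf : LipschitzWith K f) (hr : 0 < r) (hL : 0 < L)
    (hT : 0 < T) (hfL : ∀ x, ‖f x‖ ≤ L * (1 + ‖x‖)) (hCcl : IsClosed C)
    (hC : DirProxRegular r f C) {u₀ : H} (hu₀ : u₀ ∈ C) :
    ∃ u : ℝ → H, IsSweepingSol (fun _ => C) f T u₀ u := by
  obtain ⟨B, hB, happ⟩ := exists_isApproxVelocity hr hL hT hfL hC hu₀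
  set ε : ℕ → ℝ := fun n => 1 / ((n : ℝ) + 1) with hε
  have hε0 : ∀ n, 0 < ε n := fun n => by positivity
  have hεlim : Tendsto ε atTop (𝓝 0) := tendsto_one_div_add_atTop_nhds_zero_nat
  have hεanti : ∀ {n m : ℕ}, n ≤ m → ε m ≤ ε n := fun h => by
    simp only [hε]
    gcongr
  choose g hg hgB using fun n => happ (ε n) (hε0 n)
  set v : ℕ → ℝ → H := fun n t => u₀ + ∫ s in (0 : ℝ)..t, g n s with hv
  set μ := volume.restrict (Icc (0 : ℝ) T) with hμ
  have hae : ∀ n, ∀ᵐ t ∂μ, ‖g n t‖ ≤ 2 * B ∧ IsApproxVelocity C f r B (ε n) (v n t) (g n t) :=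
    fun n => (ae_restrict_mem measurableSet_Icc).mono fun t ht => hgB n t ht
  set b : ℕ → ℝ := fun n => √(2 * ((K + 2 * B / r) * (ε n + ε n) ^ 2 + 2 * B * (ε n + ε n)) * T *
    Real.exp (2 * (2 * K + 2 * B / r) * T)) with hb
  have hblim : Tendsto b atTop (𝓝 0) := by
    have h2 := hεlim.add hεlim
    have := (((((h2.pow 2).const_mul (K + 2 * B / r)).add (h2.const_mul (2 * B))).const_mul
      2).mul_const T).mul_const (Real.exp (2 * (2 * K + 2 * B / r) * T))
    simpa using this.sqrt
  have hcauchy : ∀ t ∈ Icc (0 : ℝ) T, ∀ n m k : ℕ, k ≤ n → k ≤ m → dist (v n t) (v m t) ≤ b k := by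
    intro t ht n m k hn hm
    rw [dist_eq_norm]
    refine Real.le_sqrt_of_sq_le ?_
    have := norm_integral_sub_sq_le_of_isApproxVelocity hf hr hB.le (hε0 n).le (hε0 m).le hT.le
      (hg n) (hg m) ((hae n).mono fun _ h => h.1) ((hae m).mono fun _ h => h.1)
      ((hae n).mono fun _ h => h.2) ((hae m).mono fun _ h => h.2) ht
    refine this.trans ?_
    have h0 := (hε0 n).le
    have h0' := (hε0 m).le
    have h1 := hεanti hn
    have h2 := hεanti hm
    gcongr
  have hlim : ∀ t, ∃ x, t ∈ Icc (0 : ℝ) T → Tendsto (fun n => v n t) atTop (𝓝 x) := by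
    intro t
    by_cases ht : t ∈ Icc 0 T
    · obtain ⟨x, hx⟩ := cauchySeq_tendsto_of_complete
        (cauchySeq_of_le_tendsto_0 b (hcauchy t ht) hblim)
      exact ⟨x, fun _ => hx⟩
    · exact ⟨0, fun h => absurd h ht⟩
  choose u hu using hlim
  have hub : ∀ t ∈ Icc (0 : ℝ) T, ∀ n, ‖v n t - u t‖ ≤ b n := by
    intro t ht n
    rw [← dist_eq_norm]
    refine le_of_tendsto ((tendsto_const_nhds (x := v n t)).dist (hu t ht)) ?_
    filter_upwards [eventually_ge_atTop n] with m hm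
    exact hcauchy t ht n m n le_rfl hm
  obtain ⟨w, hw, φ, hφ, hφt, hweak⟩ := exists_weak_limit_of_ae_norm_le (μ := μ) (G := g)
    (by positivity) (fun n => (hg n).aestronglyMeasurable) (fun n => (hae n).mono fun _ h => h.1)
  have hwint : IntegrableOn w (Icc 0 T) := hw.integrable one_le_two
  have h0T : (0 : ℝ) ∈ Icc 0 T := left_mem_Icc.2 hT.le
  have hset : ∀ (k : ℝ → H), IntegrableOn k (Icc 0 T) → ∀ t ∈ Icc (0 : ℝ) T, ∀ z : H,
      ∫ s in Ioc 0 t, inner ℝ (k s) z ∂μ = inner ℝ (∫ s in (0 : ℝ)..t, k s) z := by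
    intro k hk t ht z
    have hsub : Ioc 0 t ⊆ Icc 0 T := fun s hs => ⟨hs.1.le, hs.2.trans ht.2⟩
    rw [hμ, Measure.restrict_restrict_of_subset hsub, intervalIntegral.integral_of_le ht.1,
      real_inner_comm, ← integral_inner (hk.mono_set hsub)]
    simp only [real_inner_comm]
  have huw : ∀ t ∈ Icc (0 : ℝ) T, u t = u₀ + ∫ s in (0 : ℝ)..t, w s := by
    intro t ht
    rw [← sub_eq_iff_eq_add']
    refine ext_inner_right ℝ fun z => ?_
    have h1 := hweak (fun _ => z) (memLp_const z) (Ioc 0 t) measurableSet_Ioc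
    rw [hset w hwint t ht z] at h1
    refine tendsto_nhds_unique ?_ h1
    have h2 : Tendsto (fun n => inner ℝ (v n t - u₀) z) φ (𝓝 (inner ℝ (u t - u₀) z)) :=
      (((hu t ht).mono_left hφt).sub_const u₀).inner tendsto_const_nhds
    refine h2.congr fun n => ?_
    rw [hset (g n) (hg n) t ht z, hv, add_sub_cancel_left]
  have hucont : ContinuousOn u (Icc 0 T) := by
    have h1 := intervalIntegral.continuousOn_primitive_interval (a := 0) (b := T) (f := w)
      (by rwa [uIcc_of_le hT.le])
    rw [uIcc_of_le hT.le] at h1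
    exact (continuousOn_const.add h1).congr huw
  have hdlim : Tendsto (fun n => ε n + b n) atTop (𝓝 0) := by simpa using hεlim.add hblim
  have huC : ∀ t ∈ Icc (0 : ℝ) T, u t ∈ C := by
    intro t ht
    refine hCcl.closure_subset (Metric.mem_closure_iff.2 fun δ hδ => ?_)
    obtain ⟨n, hn⟩ := (hdlim.eventually_lt_const hδ).exists
    obtain ⟨p, hp, -, -, hxp, -⟩ := (hgB n t ht).2
    refine ⟨p, hp, lt_of_le_of_lt ?_ hn⟩
    have h1 := dist_triangle_left (u t) p (v n t)
    rw [dist_eq_norm (v n t), dist_eq_norm (v n t)] at h1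
    have := hub t ht n
    linarith
  have hineq : ∀ y ∈ C, ∀ᵐ t ∂μ,
      inner ℝ (f (u t) - w t) (y - u t) ≤ B / (2 * r) * ‖y - u t‖ ^ 2 := by
    intro y hy
    have hyu : ContinuousOn (fun t => y - u t) (Icc 0 T) := continuousOn_const.sub hucont
    obtain ⟨R, hR⟩ := isCompact_Icc.exists_bound_of_continuousOn hyu
    have hψ : MemLp (fun t => y - u t) 2 μ :=
      .of_bound (hyu.aestronglyMeasurable measurableSet_Icc) R
        ((ae_restrict_mem measurableSet_Icc).mono hR)
    set k : ℝ → ℝ := fun t => inner ℝ (f (u t)) (y - u t) - B / (2 * r) * ‖y - u t‖ ^ 2 with hk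
    have hkint : Integrable k μ := by
      refine ContinuousOn.integrableOn_compact isCompact_Icc ?_
      exact ((hf.continuous.comp_continuousOn hucont).inner hyu).sub
        (continuousOn_const.mul (hyu.norm.pow 2))
    set e : ℕ → ℝ := fun n => B / (2 * r) * (2 * R * (ε n + b n) + (ε n + b n) ^ 2) +
      B * (ε n + b n) + K * (ε n + b n) * R with he
    have helim : Tendsto e atTop (𝓝 0) := by
      have := (((((hdlim.const_mul (2 * R)).add (hdlim.pow 2)).const_mul (B / (2 * r))).add
        (hdlim.const_mul B)).add ((hdlim.const_mul (K : ℝ)).mul_const R))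
      simpa using this
    have hle : k ≤ᵐ[μ] fun t => inner ℝ (w t) (y - u t) := by
      refine ae_le_of_forall_setIntegral_le hkint (hw.integrable_real_inner hψ) fun A hA _ => ?_
      have h1 : Tendsto (fun n => ∫ t in A, (k t - e n) ∂μ) φ (𝓝 (∫ t in A, k t ∂μ)) := by
        have h2 : ∀ n, ∫ t in A, (k t - e n) ∂μ = ∫ t in A, k t ∂μ - μ.real A * e n := by
          intro n
          rw [integral_sub hkint.integrableOn (integrable_const _)]
          simp
        simp only [h2]
        simpa using ((helim.mono_left hφt).const_mul (μ.real A)).const_sub (∫ t in A, k t ∂μ)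
      refine le_of_tendsto_of_tendsto' h1 (hweak _ hψ A hA) fun n => ?_
      have hgn : MemLp (g n) 2 μ :=
        .of_bound (hg n).aestronglyMeasurable _ ((hae n).mono fun _ h => h.1)
      refine integral_mono_ae (hkint.integrableOn.sub (integrable_const _))
        (hgn.integrable_real_inner hψ).integrableOn (ae_restrict_of_ae ?_)
      filter_upwards [ae_restrict_mem measurableSet_Icc] with t ht
      have h3 := (hgB n t ht).2.inner_sub_le_add hf hr (hub t ht n) hy (hR t ht)
      rw [inner_sub_left] at h3
      simp only [hk, he]
      linarith
    filter_upwards [hle] with t ht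
    simp only [hk] at ht
    rw [inner_sub_left]
    linarith
  have : SecondCountableTopology H := UniformSpace.secondCountable_of_separable H
  obtain ⟨D, hDc, hD⟩ := TopologicalSpace.exists_countable_dense C
  refine ⟨u, w, hwint, huw, huC, ?_⟩
  have hall : ∀ᵐ t ∂μ, ∀ y ∈ D,
      inner ℝ (f (u t) - w t) ((y : H) - u t) ≤ B / (2 * r) * ‖(y : H) - u t‖ ^ 2 :=
    (ae_ball_iff hDc).2 fun y _ => hineq y y.2
  filter_upwards [hall, ae_restrict_mem measurableSet_Icc] with t ht htm
  refine mem_proxNormalCone_iff.2 ⟨huC t htm, B / (2 * r), by positivity, fun y hy => ?_⟩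
  have hclosed : IsClosed {y : C |
      inner ℝ (f (u t) - w t) ((y : H) - u t) ≤ B / (2 * r) * ‖(y : H) - u t‖ ^ 2} :=
    isClosed_le (by fun_prop) (by fun_prop)
  have := hclosed.closure_subset_iff.2 ht (hD ⟨y, hy⟩)
  exact this

end SweepingProcess

/-- **Sweeping process in a Hilbert space, constant set, linear-growth Lipschitz
perturbation.** Let `H` be a separable Hilbert space, `f : H → H` Lipschitz with at most
linear growth, `r > 0` and `C` a nonempty closed `(r,f)`-prox-regular subset of `H`.
Then for every `u₀ ∈ C` the sweeping process `u̇(t) + N(C,u(t)) ∋ f(u(t))`, `u(0) = u₀`,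
has one and only one absolutely continuous solution `u`, and `u(t) ∈ C` on `I`. -/
theorem sweeping_process_hilbert_constant
    {H : Type*} [NormedAddCommGroup H] [InnerProductSpace ℝ H] [CompleteSpace H]
    [TopologicalSpace.SeparableSpace H]
    (T : ℝ) (hT : 0 < T)
    (f : H → H) (K : NNReal) (hflip : LipschitzWith K f)
    (L : ℝ) (hL : 0 < L) (hfgrowth : ∀ x, ‖f x‖ ≤ L * (1 + ‖x‖))
    (r : ℝ) (hr : 0 < r)
    (C : Set H) (hCne : C.Nonempty) (hCclosed : IsClosed C)
    (hCprox : DirProxRegular r f C)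
    (u₀ : H) (hu₀ : u₀ ∈ C) :
    (∃ u : ℝ → H, IsSweepingSol (fun _ => C) f T u₀ u) ∧
      ∀ u v : ℝ → H, IsSweepingSol (fun _ => C) f T u₀ u →
        IsSweepingSol (fun _ => C) f T u₀ v → Set.EqOn u v (Set.Icc 0 T) := by
  exact ⟨exists_isSweepingSol hflip hr hL hT hfgrowth hCclosed hCprox hu₀,
    fun _ _ hu hv => hu.eqOn hflip hr hCprox hT.le hv⟩
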